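/- arXiv:2311.16178 — 2 statements merged into one kernel-verified Lean document; each statement's English description precedes it below -/
import Mathlib

section
/- Let ω_{p,q} be the Grunsky coefficients of f₂(z)=√(f(z²)) for f ∈ S. Then 3ω₁₅ − 3ω₁₁ω₁₃ + ω₁₁³ − 3ω₃₃ = 0 and ω₁₇ − ω₃₅ − ω₁₁ω₃₃ − ω₁₃² + ω₁₁⁴/3 = 0; in particular ω₃₃ = ω₁₅ − ω₁₁ω₁₃ + ω₁₁³/3. -/
open Filter Topology

/-- The Maclaurin series of a function, as a formal power series. -/
noncomputable def maclaurin (φ : ℂ → ℂ) : PowerSeries ℂ :=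
  PowerSeries.mk fun n => iteratedDeriv n φ 0 / n.factorial

theorem maclaurin_congr {φ ψ : ℂ → ℂ} (h : φ =ᶠ[𝓝 0] ψ) : maclaurin φ = maclaurin ψ := by
  ext n
  simp [maclaurin, h.iteratedDeriv_eq n]

theorem maclaurin_eq_mk {φ : ℂ → ℂ} {a : ℕ → ℂ}
    (h : ∀ᶠ z in 𝓝 0, HasSum (fun n => a n * z ^ n) (φ z)) :
    AnalyticAt ℂ φ 0 ∧ maclaurin φ = PowerSeries.mk a := by
  have hp : HasFPowerSeriesAt φ (FormalMultilinearSeries.ofScalars ℂ a) 0 := by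
    rw [hasFPowerSeriesAt_iff]
    filter_upwards [h] with z hz
    simpa [FormalMultilinearSeries.coeff_ofScalars, mul_comm] using hz
  refine ⟨hp.analyticAt, ?_⟩
  have he := hp.analyticAt.hasFPowerSeriesAt.eq_formalMultilinearSeries hp
  ext n
  have := congrArg (fun p => FormalMultilinearSeries.coeff p n) he
  simpa [maclaurin, FormalMultilinearSeries.coeff_ofScalars] using this

theorem maclaurin_add {φ ψ : ℂ → ℂ} (hφ : AnalyticAt ℂ φ 0) (hψ : AnalyticAt ℂ ψ 0) :
    maclaurin (φ + ψ) = maclaurin φ + maclaurin ψ := by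
  ext n
  simp [maclaurin, iteratedDeriv_add hφ.contDiffAt hψ.contDiffAt, add_div]

theorem maclaurin_sub {φ ψ : ℂ → ℂ} (hφ : AnalyticAt ℂ φ 0) (hψ : AnalyticAt ℂ ψ 0) :
    maclaurin (φ - ψ) = maclaurin φ - maclaurin ψ := by
  ext n
  simp [maclaurin, iteratedDeriv_sub hφ.contDiffAt hψ.contDiffAt, sub_div]

theorem maclaurin_mul {φ ψ : ℂ → ℂ} (hφ : AnalyticAt ℂ φ 0) (hψ : AnalyticAt ℂ ψ 0) :
    maclaurin (φ * ψ) = maclaurin φ * maclaurin ψ := by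
  ext n
  simp only [maclaurin, PowerSeries.coeff_mk, PowerSeries.coeff_mul]
  rw [iteratedDeriv_mul hφ.contDiffAt hψ.contDiffAt, Finset.sum_div,
    Finset.Nat.sum_antidiagonal_eq_sum_range_succ_mk]
  refine Finset.sum_congr rfl fun i hi => ?_
  have hi' : i ≤ n := by simpa [Nat.lt_succ_iff] using hi
  have hc : (n.choose i : ℂ) * i.factorial * (n - i).factorial = n.factorial := by
    exact_mod_cast Nat.choose_mul_factorial_mul_factorial hi'
  have h1 : (i.factorial : ℂ) ≠ 0 := by exact_mod_cast i.factorial_ne_zero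
  have h2 : ((n - i).factorial : ℂ) ≠ 0 := by exact_mod_cast (n - i).factorial_ne_zero
  have h3 : (n.factorial : ℂ) ≠ 0 := by exact_mod_cast n.factorial_ne_zero
  field_simp
  rw [← hc]
  ring

theorem maclaurin_pow {φ : ℂ → ℂ} (hφ : AnalyticAt ℂ φ 0) (k : ℕ) :
    maclaurin (φ ^ k) = maclaurin φ ^ k := by
  induction k with
  | zero =>
    ext n
    rcases n with _ | n
    · simp [maclaurin]
    · have : (1 : ℂ → ℂ) = fun _ => 1 := rfl
      simp [maclaurin, this, iteratedDeriv_const, PowerSeries.coeff_one]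
  | succ k ih => rw [pow_succ, pow_succ, maclaurin_mul (hφ.pow k) hφ, ih]

theorem maclaurin_const (c : ℂ) : maclaurin (fun _ => c) = PowerSeries.C c := by
  ext n
  rcases n with _ | n
  · simp [maclaurin]
  · simp [maclaurin, iteratedDeriv_const]

theorem maclaurin_id : maclaurin id = PowerSeries.X := by
  refine (maclaurin_eq_mk (a := fun n => if n = 1 then 1 else 0) (.of_forall fun z => ?_)).2.trans ?_
  · convert! hasSum_single (f := fun n : ℕ => (if n = 1 then (1 : ℂ) else 0) * z ^ n) 1 ?_ using 1
    · simp
    · intro n hn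
      simp [hn]
  · ext n
    simp [PowerSeries.coeff_X]

theorem coeff_maclaurin_deriv (φ : ℂ → ℂ) (n : ℕ) :
    PowerSeries.coeff n (maclaurin (deriv φ)) =
      (n + 1) * PowerSeries.coeff (n + 1) (maclaurin φ) := by
  have h3 : (n.factorial : ℂ) ≠ 0 := by exact_mod_cast n.factorial_ne_zero
  have h4 : (n + 1 : ℂ) ≠ 0 := by exact_mod_cast n.succ_ne_zero
  simp only [maclaurin, PowerSeries.coeff_mk, iteratedDeriv_succ', Nat.factorial_succ]
  push_cast
  field_simp

theorem coeff_maclaurin_eq_zero_of_odd {φ : ℂ → ℂ} (h : ∀ᶠ z in 𝓝 0, φ (-z) = -φ z) {n : ℕ}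
    (hn : Even n) : PowerSeries.coeff n (maclaurin φ) = 0 := by
  have h1 : (fun z => φ (-z)) =ᶠ[𝓝 0] fun z => -φ z := h
  have h2 := h1.iteratedDeriv_eq n
  rw [iteratedDeriv_comp_neg, iteratedDeriv_fun_neg] at h2
  simp only [neg_zero, hn.neg_one_pow, one_smul] at h2
  have : iteratedDeriv n φ 0 = 0 := self_eq_neg.mp h2
  simp [maclaurin, this]

/-- Low-order coefficients of `(h' (t - z) - 1) (c - g) = -g' (t - z)`, the logarithmic derivative
of `exp h (t - z) = c - g`. -/
theorem coeff_of_exp_mul_eq {h g : ℂ → ℂ} (hh : AnalyticAt ℂ h 0) (hg : AnalyticAt ℂ g 0) {t c : ℂ}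
    (he : ∀ᶠ z in 𝓝 0, Complex.exp (h z) * (t - z) = c - g z)
    (H0 : PowerSeries.coeff 0 (maclaurin g) = 0) (H1 : PowerSeries.coeff 1 (maclaurin g) = 1)
    (H2 : PowerSeries.coeff 2 (maclaurin g) = 0) :
    (PowerSeries.coeff 1 (maclaurin h) * t - 1) * c = -t ∧
    (2 * PowerSeries.coeff 2 (maclaurin h) * t - PowerSeries.coeff 1 (maclaurin h)) * c
      = PowerSeries.coeff 1 (maclaurin h) * t ∧
    (3 * PowerSeries.coeff 3 (maclaurin h) * t - 2 * PowerSeries.coeff 2 (maclaurin h)) * c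
      - (2 * PowerSeries.coeff 2 (maclaurin h) * t - PowerSeries.coeff 1 (maclaurin h))
      = -3 * PowerSeries.coeff 3 (maclaurin g) * t := by
  have key : (deriv h * ((fun _ => t) - id) - fun _ => 1) * ((fun _ => c) - g) =ᶠ[𝓝 0]
      deriv g * (id - fun _ => t) := by
    filter_upwards [he.eventually_nhds, hh.eventually_analyticAt, hg.eventually_analyticAt]
      with z hz hhz hgz
    have hd1 : HasDerivAt (fun z => Complex.exp (h z) * (t - z))
        (Complex.exp (h z) * deriv h z * (t - z) + Complex.exp (h z) * (-1)) z :=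
      hhz.differentiableAt.hasDerivAt.cexp.mul ((hasDerivAt_id z).const_sub t)
    have hd2 : HasDerivAt (fun z => c - g z) (-deriv g z) z :=
      hgz.differentiableAt.hasDerivAt.const_sub c
    have hd := (hd1.congr_of_eventuallyEq (EventuallyEq.symm hz)).unique hd2
    have := hz.self_of_nhds
    simp only [Pi.mul_apply, Pi.sub_apply, id]
    linear_combination (t - z) * hd - (deriv h z * (t - z) - 1) * this
  have hid : AnalyticAt ℂ (id : ℂ → ℂ) 0 := analyticAt_id
  have hM := maclaurin_congr key
  rw [maclaurin_mul (((hh.deriv.mul (analyticAt_const.sub hid)).sub analyticAt_const))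
      (analyticAt_const.sub hg), maclaurin_sub (hh.deriv.mul (analyticAt_const.sub hid))
      analyticAt_const, maclaurin_mul hh.deriv (analyticAt_const.sub hid),
    maclaurin_mul hg.deriv (hid.sub analyticAt_const), maclaurin_sub analyticAt_const hid,
    maclaurin_sub hid analyticAt_const, maclaurin_sub analyticAt_const hg, maclaurin_id] at hM
  simp only [maclaurin_const] at hM
  have e0 := congrArg (PowerSeries.coeff 0) hM
  have e1 := congrArg (PowerSeries.coeff 1) hM
  have e2 := congrArg (PowerSeries.coeff 2) hM
  simp only [PowerSeries.coeff_mul, Finset.Nat.sum_antidiagonal_eq_sum_range_succ_mk,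
    Finset.sum_range_succ, Finset.sum_range_zero, map_sub, coeff_maclaurin_deriv,
    PowerSeries.coeff_C, PowerSeries.coeff_X] at e0 e1 e2
  norm_num at e0 e1 e2 H0
  simp only [H0, H1, H2] at e0 e1 e2
  refine ⟨?_, ?_, ?_⟩
  · linear_combination e0
  · linear_combination e1
  · linear_combination e2

/-- Coefficient comparison in `A₃ = (t⁻³ - (t⁻¹ - A₁)³) / 3 - c (t⁻¹ - A₁)` for odd `A₁`. -/
theorem coeff_of_cubic_relation {a d : ℕ → ℂ} {c : ℂ} (ha : ∀ n, Even n → a n = 0)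
    (h : PowerSeries.X ^ 3 * PowerSeries.mk d = PowerSeries.X * PowerSeries.mk a
      - PowerSeries.X ^ 2 * PowerSeries.mk a ^ 2
      + PowerSeries.C (1 / 3) * (PowerSeries.X ^ 3 * PowerSeries.mk a ^ 3)
      - PowerSeries.C c * PowerSeries.X ^ 2
      + PowerSeries.C c * (PowerSeries.X ^ 3 * PowerSeries.mk a)) :
    c = a 1 ∧ d 3 = a 5 - 2 * a 1 * a 3 + a 1 ^ 3 / 3 + c * a 3 ∧
      d 5 = a 7 - 2 * a 1 * a 5 - a 3 ^ 2 + a 1 ^ 2 * a 3 + c * a 5 := by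
  have z0 := ha 0 (by decide)
  have z2 := ha 2 (by decide)
  have z4 := ha 4 (by decide)
  have z6 := ha 6 (by decide)
  have sq : ∀ n, PowerSeries.coeff n (PowerSeries.mk a ^ 2)
      = ∑ k ∈ Finset.range (n + 1), a k * a (n - k) := fun n => by
    rw [pow_two, PowerSeries.coeff_mul, Finset.Nat.sum_antidiagonal_eq_sum_range_succ_mk]
    simp
  have cube : ∀ n, PowerSeries.coeff n (PowerSeries.mk a ^ 3)
      = ∑ k ∈ Finset.range (n + 1),
        PowerSeries.coeff k (PowerSeries.mk a ^ 2) * a (n - k) := fun n => by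
    rw [pow_succ, PowerSeries.coeff_mul, Finset.Nat.sum_antidiagonal_eq_sum_range_succ_mk]
    simp
  have s0 : PowerSeries.coeff 0 (PowerSeries.mk a ^ 2) = 0 := by
    simp [sq, z0]
  have s1 : PowerSeries.coeff 1 (PowerSeries.mk a ^ 2) = 0 := by
    simp [sq, Finset.sum_range_succ, z0]
  have s2 : PowerSeries.coeff 2 (PowerSeries.mk a ^ 2) = a 1 ^ 2 := by
    simp [sq, Finset.sum_range_succ, z0, z2]
    ring
  have s3 : PowerSeries.coeff 3 (PowerSeries.mk a ^ 2) = 0 := by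
    simp [sq, Finset.sum_range_succ, z0, z2]
  have s4 : PowerSeries.coeff 4 (PowerSeries.mk a ^ 2) = 2 * a 1 * a 3 := by
    simp [sq, Finset.sum_range_succ, z0, z2, z4]
    ring
  have s5 : PowerSeries.coeff 5 (PowerSeries.mk a ^ 2) = 0 := by
    simp [sq, Finset.sum_range_succ, z0, z2, z4]
  have s6 : PowerSeries.coeff 6 (PowerSeries.mk a ^ 2) = 2 * a 1 * a 5 + a 3 ^ 2 := by
    simp [sq, Finset.sum_range_succ, z0, z2, z4, z6]
    ring
  have c3 : PowerSeries.coeff 3 (PowerSeries.mk a ^ 3) = a 1 ^ 3 := by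
    simp [cube, Finset.sum_range_succ, s0, s1, s2, s3, z0]
    ring
  have c5 : PowerSeries.coeff 5 (PowerSeries.mk a ^ 3) = 3 * a 1 ^ 2 * a 3 := by
    simp [cube, Finset.sum_range_succ, s0, s1, s2, s3, s4, s5, z0]
    ring
  have e2 := congrArg (PowerSeries.coeff 2) h
  have e6 := congrArg (PowerSeries.coeff 6) h
  have e8 := congrArg (PowerSeries.coeff 8) h
  simp only [map_add, map_sub, PowerSeries.coeff_X_pow_mul', PowerSeries.coeff_C_mul,
    PowerSeries.coeff_succ_X_mul, PowerSeries.coeff_X_pow, PowerSeries.coeff_mk] at e2 e6 e8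
  norm_num [s0, s4, s6, c3, c5] at e2 e6 e8
  refine ⟨?_, ?_, ?_⟩
  · linear_combination e2
  · linear_combination e6
  · linear_combination e8

theorem stmt_6 (f : ℂ → ℂ) (hA : AnalyticOn ℂ f (Metric.ball 0 1))
    (hI : Set.InjOn f (Metric.ball 0 1))
    (hf0 : f 0 = 0) (hf1 : deriv f 0 = 1)
    (f₂ : ℂ → ℂ) (hA₂ : AnalyticOn ℂ f₂ (Metric.ball 0 1))
    (hsq : ∀ z ∈ Metric.ball (0:ℂ) 1, (f₂ z) ^ 2 = f (z ^ 2))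
    (hd₂ : deriv f₂ 0 = 1)
    (ω : ℕ → ℕ → ℂ) (hsym : ∀ p q, ω p q = ω q p)
    (hω : ∀ t ∈ Metric.ball (0:ℂ) 1, ∀ z ∈ Metric.ball (0:ℂ) 1, t ≠ z →
      ∃ w, HasSum (fun pq : ℕ × ℕ => ω pq.1 pq.2 * t ^ pq.1 * z ^ pq.2) w ∧
        Complex.exp w = (f₂ t - f₂ z) / (t - z)) :
    (3 * ω 1 5 - 3 * ω 1 1 * ω 1 3 + ω 1 1 ^ 3 - 3 * ω 3 3 = 0 ∧
     ω 1 7 - ω 3 5 - ω 1 1 * ω 3 3 - ω 1 3 ^ 2 + ω 1 1 ^ 4 / 3 = 0) ∧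
    ω 3 3 = ω 1 5 - ω 1 1 * ω 1 3 + ω 1 1 ^ 3 / 3 := by
  have hB : ∀ᶠ z : ℂ in 𝓝 0, z ∈ Metric.ball (0 : ℂ) 1 := Metric.ball_mem_nhds 0 one_pos
  have h0B : (0 : ℂ) ∈ Metric.ball (0 : ℂ) 1 := by simp
  have hinj : ∀ t ∈ Metric.ball (0 : ℂ) 1, ∀ z ∈ Metric.ball (0 : ℂ) 1, t ≠ z → f₂ t ≠ f₂ z := by
    intro t ht z hz htz heq
    obtain ⟨w, -, hw⟩ := hω t ht z hz htz
    rw [heq, sub_self, zero_div] at hw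
    exact Complex.exp_ne_zero w hw
  have hf20 : f₂ 0 = 0 := by simpa [hf0] using hsq 0 h0B
  have hodd : ∀ z ∈ Metric.ball (0 : ℂ) 1, f₂ (-z) = -f₂ z := by
    intro z hz
    by_cases h0 : z = 0
    · simp [h0, hf20]
    have hz' : -z ∈ Metric.ball (0 : ℂ) 1 := by simpa using hz
    have h : f₂ (-z) ^ 2 = f₂ z ^ 2 := by rw [hsq _ hz', hsq _ hz, neg_sq]
    exact (sq_eq_sq_iff_eq_or_eq_neg.mp h).resolve_left
      (hinj _ hz' _ hz fun e => h0 (neg_eq_self.mp e))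
  have hf2 : AnalyticAt ℂ f₂ 0 :=
    (Metric.isOpen_ball.analyticOn_iff_analyticOnNhd.mp hA₂) 0 h0B
  have F0 : PowerSeries.coeff 0 (maclaurin f₂) = 0 := by simp [maclaurin, hf20]
  have F1 : PowerSeries.coeff 1 (maclaurin f₂) = 1 := by simp [maclaurin, hd₂]
  have F2 : PowerSeries.coeff 2 (maclaurin f₂) = 0 :=
    coeff_maclaurin_eq_zero_of_odd (hB.mono hodd) even_two
  set c := PowerSeries.coeff 3 (maclaurin f₂)
  have hsum : ∀ q, ∀ t ∈ Metric.ball (0 : ℂ) 1, Summable fun p => ω p q * t ^ p := by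
    intro q t ht
    obtain ⟨z, hz, hz0, hzt⟩ : ∃ z ∈ Metric.ball (0 : ℂ) 1, z ≠ 0 ∧ t ≠ z := by
      by_cases h : t = 1 / 2
      · exact ⟨1 / 3, by norm_num, by norm_num, by rw [h]; norm_num⟩
      · exact ⟨1 / 2, by norm_num, by norm_num, h⟩
    obtain ⟨w, hw, -⟩ := hω t ht z hz hzt
    have hs := hw.summable.comp_injective (i := fun p : ℕ => (p, q))
      fun a b hab => (Prod.mk.inj hab).1
    exact (summable_mul_right_iff (pow_ne_zero q hz0)).mp hs
  set A : ℕ → ℂ → ℂ := fun q t => ∑' p, ω p q * t ^ p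
  have hAsum : ∀ q, ∀ t ∈ Metric.ball (0 : ℂ) 1, HasSum (fun p => ω p q * t ^ p) (A q t) :=
    fun q t ht => (hsum q t ht).hasSum
  have hAM := fun q => maclaurin_eq_mk (hB.mono (hAsum q))
  have hcoef : ∀ t ∈ Metric.ball (0 : ℂ) 1, t ≠ 0 →
      (A 1 t * t - 1) * f₂ t = -t ∧ (2 * A 2 t * t - A 1 t) * f₂ t = A 1 t * t ∧
      (3 * A 3 t * t - 2 * A 2 t) * f₂ t - (2 * A 2 t * t - A 1 t) = -3 * c * t := by
    intro t ht ht0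
    have hrow : ∀ z ∈ Metric.ball (0 : ℂ) 1, t ≠ z → ∃ w, HasSum (fun q => A q t * z ^ q) w ∧
        Complex.exp w = (f₂ t - f₂ z) / (t - z) := by
      intro z hz htz
      obtain ⟨w, hw, he⟩ := hω t ht z hz htz
      refine ⟨w, ?_, he⟩
      have hw' := (Equiv.prodComm ℕ ℕ).hasSum_iff.mpr hw
      exact hw'.prod_fiberwise fun q => (hAsum q t ht).mul_right (z ^ q)
    have hne : ∀ᶠ z : ℂ in 𝓝 0, t ≠ z := eventually_ne_nhds (Ne.symm ht0) |>.mono fun _ => Ne.symm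
    have hps := maclaurin_eq_mk (φ := fun z => ∑' q, A q t * z ^ q) (a := fun q => A q t) (by
      filter_upwards [hB, hne] with z hz htz
      obtain ⟨w, hw, -⟩ := hrow z hz htz
      exact hw.summable.hasSum)
    have := coeff_of_exp_mul_eq hps.1 hf2 (t := t) (c := f₂ t) (by
      filter_upwards [hB, hne] with z hz htz
      obtain ⟨w, hw, he⟩ := hrow z hz htz
      rw [hw.tsum_eq, he, div_mul_cancel₀ _ (sub_ne_zero.mpr htz)]) F0 F1 F2
    simpa only [hps.2, PowerSeries.coeff_mk] using this
  have hA1odd : ∀ᶠ t in 𝓝 0, A 1 (-t) = -A 1 t := by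
    have hneg : ContinuousAt (fun t => A 1 (-t)) 0 :=
      ContinuousAt.comp' (by simpa using (hAM 1).1.continuousAt) continuous_neg.continuousAt
    have hloc : (fun t => A 1 (-t)) =ᶠ[𝓝[≠] 0] fun t => -A 1 t := by
      filter_upwards [hB.filter_mono nhdsWithin_le_nhds, self_mem_nhdsWithin] with t ht ht0
      have hft : f₂ t ≠ 0 := by simpa [hf20] using hinj t ht 0 h0B ht0
      have e0 := (hcoef t ht ht0).1
      have e0' := (hcoef (-t) (by simpa using ht) (neg_ne_zero.mpr ht0)).1
      rw [hodd t ht] at e0'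
      refine mul_right_cancel₀ (mul_ne_zero ht0 hft) ?_
      linear_combination e0 + e0'
    exact (hneg.eventuallyEq_nhds_iff_eventuallyEq_nhdsNE (hAM 1).1.continuousAt.neg).mp hloc
  have hA3 : (id ^ 3 * A 3 : ℂ → ℂ) =ᶠ[𝓝 0]
      (id * A 1 - id ^ 2 * A 1 ^ 2 + (fun _ => 1 / 3) * (id ^ 3 * A 1 ^ 3) - (fun _ => c) * id ^ 2
        + (fun _ => c) * (id ^ 3 * A 1) : ℂ → ℂ) := by
    filter_upwards [hB] with t ht
    simp only [Pi.mul_apply, Pi.add_apply, Pi.sub_apply, Pi.pow_apply, id]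
    by_cases ht0 : t = 0
    · simp [ht0]
    obtain ⟨e0, e1, e2⟩ := hcoef t ht ht0
    have hft : f₂ t ≠ 0 := by simpa [hf20] using hinj t ht 0 h0B ht0
    have e1' : 2 * A 2 t * t - A 1 t = A 1 t * (1 - A 1 t * t) := by
      refine mul_right_cancel₀ hft ?_
      linear_combination e1 + A 1 t * e0
    have e2' : (3 * A 3 t * t - 2 * A 2 t) * t
        = (1 - A 1 t * t) * (2 * A 2 t * t - A 1 t - 3 * c * t) := by
      linear_combination (1 - A 1 t * t) * e2 + (3 * A 3 t * t - 2 * A 2 t) * e0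
    linear_combination t / 3 * e2' + t / 3 * (1 + (1 - A 1 t * t)) * e1'
  have han := (hAM 1).1
  have hid : AnalyticAt ℂ (id : ℂ → ℂ) 0 := analyticAt_id
  have hk : ∀ k : ℂ, AnalyticAt ℂ (fun _ : ℂ => k) 0 := fun _ => analyticAt_const
  have hM := maclaurin_congr hA3
  have t1 := hid.mul han
  have t2 := (hid.pow 2).mul (han.pow 2)
  have t3 := (hid.pow 3).mul (han.pow 3)
  have t4 := (hid.pow 3).mul han
  rw [maclaurin_mul (hid.pow 3) (hAM 3).1,
    maclaurin_add (((t1.sub t2).add ((hk _).mul t3)).sub ((hk _).mul (hid.pow 2)))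
      ((hk _).mul t4),
    maclaurin_sub ((t1.sub t2).add ((hk _).mul t3)) ((hk _).mul (hid.pow 2)),
    maclaurin_add (t1.sub t2) ((hk _).mul t3), maclaurin_sub t1 t2, maclaurin_mul hid han,
    maclaurin_mul (hid.pow 2) (han.pow 2), maclaurin_mul (hk _) t3, maclaurin_mul (hk _) t4,
    maclaurin_mul (hk _) (hid.pow 2), maclaurin_mul (hid.pow 3) (han.pow 3),
    maclaurin_mul (hid.pow 3) han, maclaurin_pow hid, maclaurin_pow hid, maclaurin_pow han,
    maclaurin_pow han, maclaurin_id, maclaurin_const, maclaurin_const, (hAM 1).2, (hAM 3).2] at hM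
  have heven : ∀ n, Even n → ω n 1 = 0 := fun n hn => by
    simpa [(hAM 1).2] using coeff_maclaurin_eq_zero_of_odd hA1odd hn
  obtain ⟨hc1, h3, h5⟩ := coeff_of_cubic_relation heven hM
  rw [hc1] at h3 h5
  simp only [hsym 3 1, hsym 5 1, hsym 7 1, hsym 5 3] at h3 h5
  refine ⟨⟨?_, ?_⟩, ?_⟩
  · linear_combination -3 * h3
  · linear_combination -h5 - ω 1 1 * h3
  · linear_combination h3
end

section
/- If f ∈ S has logarithmic coefficient γ₄, then γ₄ = ω₁₇ + ω₁₁ω₁₅ + ω₁₁²ω₁₃ + ω₁₃²/2 + ω₁₁⁴/4, where ω_{p,q} are the Grunsky coefficients of f₂(z)=√(f(z²)). -/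
open Filter Topology in
/-- A function given by a power series on a closed disc has that series as its Taylor series. -/
theorem analyticAt_and_iteratedDeriv_of_hasSum {c : ℕ → ℂ} {F : ℂ → ℂ} {r : ℝ} (hr : 0 < r)
    (h : ∀ z : ℂ, ‖z‖ ≤ r → HasSum (fun n => c n * z ^ n) (F z)) :
    AnalyticAt ℂ F 0 ∧ ∀ n, iteratedDeriv n F 0 = n.factorial * c n := by
  have hs : HasFPowerSeriesOnBall F (FormalMultilinearSeries.ofScalars ℂ c) 0
      (ENNReal.ofReal r) := by
    refine ⟨?_, by simpa using hr, ?_⟩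
    · have := (h r (by simp [abs_of_pos hr])).summable.norm
      apply FormalMultilinearSeries.le_radius_of_summable
      simpa [FormalMultilinearSeries.ofScalars_norm, abs_of_pos hr, hr.le] using this
    · intro y hy
      rw [Metric.eball_ofReal] at hy
      have := h y (by simpa using (Metric.mem_ball.1 hy).le)
      simpa [FormalMultilinearSeries.ofScalars_apply_eq, mul_comm] using this
  refine ⟨hs.analyticAt, fun n => ?_⟩
  have hu := hs.hasFPowerSeriesAt.eq_formalMultilinearSeries hs.analyticAt.hasFPowerSeriesAt
  rw [FormalMultilinearSeries.ofScalars_series_eq_iff] at hu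
  have hn := congrFun hu n
  have hf : (n.factorial : ℂ) ≠ 0 := by exact_mod_cast n.factorial_ne_zero
  rw [hn]
  field_simp

open Filter Topology in
/-- The recursion for the coefficients of the exponential of a power series. -/
theorem coeff_recursion_of_exp {w v : ℕ → ℂ} {r : ℝ} (hr : 0 < r)
    (h : ∀ z : ℂ, ‖z‖ ≤ r → z ≠ 0 →
      ∃ W, HasSum (fun n => w n * z ^ n) W ∧ HasSum (fun n => v n * z ^ n) (Complex.exp W))
    (n : ℕ) :
    (n + 1) * v (n + 1) = ∑ k ∈ Finset.range (n + 1), (k + 1) * w (k + 1) * v (n - k) := by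
  set W : ℂ → ℂ := fun z => ∑' n, w n * z ^ n with hWdef
  set V : ℂ → ℂ := fun z => ∑' n, v n * z ^ n with hVdef
  have h0 (c : ℕ → ℂ) : Summable (fun n => c n * (0 : ℂ) ^ n) :=
    summable_of_ne_finset_zero (s := {0}) (fun n hn => by simp_all)
  have hW : ∀ z : ℂ, ‖z‖ ≤ r → HasSum (fun n => w n * z ^ n) (W z) := by
    intro z hz
    apply Summable.hasSum
    rcases eq_or_ne z 0 with rfl | hz0
    · exact h0 w
    · obtain ⟨_, h1, -⟩ := h z hz hz0
      exact h1.summable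
  have hV : ∀ z : ℂ, ‖z‖ ≤ r → HasSum (fun n => v n * z ^ n) (V z) := by
    intro z hz
    apply Summable.hasSum
    rcases eq_or_ne z 0 with rfl | hz0
    · exact h0 v
    · obtain ⟨_, -, h1⟩ := h z hz hz0
      exact h1.summable
  obtain ⟨hWa, hWd⟩ := analyticAt_and_iteratedDeriv_of_hasSum hr hW
  obtain ⟨hVa, hVd⟩ := analyticAt_and_iteratedDeriv_of_hasSum hr hV
  have hEa : AnalyticAt ℂ (fun z => Complex.exp (W z)) 0 := hWa.cexp
  have hev : V =ᶠ[𝓝 0] fun z => Complex.exp (W z) := by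
    refine (AnalyticAt.frequently_eq_iff_eventually_eq hVa hEa).1 ?_
    apply Eventually.frequently
    filter_upwards [self_mem_nhdsWithin,
      nhdsWithin_le_nhds (Metric.ball_mem_nhds (0 : ℂ) hr)] with z hz0 hz
    have hz' : ‖z‖ ≤ r := by simpa using (Metric.mem_ball.1 hz).le
    obtain ⟨W', h1, h2⟩ := h z hz' hz0
    rw [(hW z hz').unique h1, (hV z hz').unique h2]
  have hder : deriv V =ᶠ[𝓝 0] fun z => deriv W z * V z := by
    filter_upwards [hev.eventuallyEq_nhds, hWa.eventually_analyticAt] with z hz hWz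
    rw [hz.deriv_eq, hz.eq_of_nhds, deriv_cexp hWz.differentiableAt, mul_comm]
  have key : iteratedDeriv (n + 1) V 0 = ∑ k ∈ Finset.range (n + 1),
      (n.choose k : ℂ) * iteratedDeriv (k + 1) W 0 * iteratedDeriv (n - k) V 0 := by
    rw [iteratedDeriv_succ', hder.iteratedDeriv_eq,
      iteratedDeriv_fun_mul hWa.deriv.contDiffAt hVa.contDiffAt]
    simp only [iteratedDeriv_succ']
  simp only [hVd, hWd] at key
  have hf : (n.factorial : ℂ) ≠ 0 := by exact_mod_cast n.factorial_ne_zero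
  apply mul_left_cancel₀ hf
  rw [Finset.mul_sum]
  trans ((n + 1).factorial : ℂ) * v (n + 1)
  · rw [Nat.factorial_succ]; push_cast; ring
  rw [key]
  refine Finset.sum_congr rfl fun k hk => ?_
  have hkn : k ≤ n := by simpa [Nat.lt_succ_iff] using hk
  have := Nat.choose_mul_factorial_mul_factorial hkn
  rw [← this, Nat.factorial_succ]
  push_cast
  ring

/-- If `exp (∑ A p * t ^ p)` is the difference quotient of `g` at `(t, z)`, where `g 0 = 0` and
`g' 0 = 1`, then `A 1` is determined by `g z = z * exp (A 0)`. -/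
theorem exp_neg_eq_of_difference_quotient {g : ℂ → ℂ} (hg : HasDerivAt g 1 0) (hg0 : g 0 = 0)
    {z : ℂ} (hz : z ≠ 0) {A : ℕ → ℂ}
    (h : ∀ t : ℂ, ‖t‖ ≤ ‖z‖ / 2 → ∃ w, HasSum (fun p => A p * t ^ p) w ∧
      Complex.exp w = (g t - g z) / (t - z)) :
    Complex.exp (-A 0) = 1 - z * A 1 := by
  have hr : 0 < ‖z‖ / 2 := by positivity
  set H : ℂ → ℂ := fun t => ∑' p, A p * t ^ p with hH
  have hs : ∀ t : ℂ, ‖t‖ ≤ ‖z‖ / 2 → HasSum (fun p => A p * t ^ p) (H t) := fun t ht =>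
    (h t ht).choose_spec.1.summable.hasSum
  have he : ∀ t : ℂ, ‖t‖ ≤ ‖z‖ / 2 → Complex.exp (H t) = (g t - g z) / (t - z) := fun t ht => by
    obtain ⟨w, h1, h2⟩ := h t ht
    rw [(hs t ht).unique h1, h2]
  obtain ⟨ha, hd⟩ := analyticAt_and_iteratedDeriv_of_hasSum hr hs
  have hH0 : H 0 = A 0 := by simpa using hd 0
  have hH1 : HasDerivAt H (A 1) 0 := by
    have := ha.differentiableAt.hasDerivAt
    rwa [show deriv H 0 = A 1 by simpa using hd 1] at this
  have hE := hH1.cexp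
  have hQ : HasDerivAt (fun t => (g t - g z) / (t - z)) _ 0 :=
    (hg.sub_const (g z)).div ((hasDerivAt_id' (0 : ℂ)).sub_const z) (by simpa using hz)
  have heq : (fun t => Complex.exp (H t)) =ᶠ[nhds 0] fun t => (g t - g z) / (t - z) := by
    filter_upwards [Metric.ball_mem_nhds (0 : ℂ) hr] with t ht
    exact he t (by simpa using (Metric.mem_ball.1 ht).le)
  have h1 := hE.unique (hQ.congr_of_eventuallyEq heq)
  have h2 := he 0 (by simpa using hr.le)
  rw [hH0] at h1 h2
  rw [hg0] at h1 h2
  have hne := Complex.exp_ne_zero (A 0)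
  rw [Complex.exp_neg]
  have h3 : g z = z * Complex.exp (A 0) := by
    rw [h2]; field_simp; ring
  rw [h3] at h1
  have hz' : (0 - z) ^ 2 ≠ 0 := by simpa using hz
  rw [eq_div_iff hz'] at h1
  apply mul_left_cancel₀ (mul_ne_zero hz hne)
  rw [mul_assoc, mul_inv_cancel₀ hne]
  linear_combination h1

/-- The logarithmic Grunsky expansion of `g` at `(t, z)` restricts to its rows: row zero is
`log (g z / z)` and row one is `(1 - z / g z) / z`. -/
theorem exists_hasSum_grunsky_rows {g : ℂ → ℂ} (hg : HasDerivAt g 1 0) (hg0 : g 0 = 0)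
    {ω : ℕ → ℕ → ℂ}
    (hω : ∀ t ∈ Metric.ball (0:ℂ) 1, ∀ z ∈ Metric.ball (0:ℂ) 1, t ≠ z →
      ∃ w, HasSum (fun pq : ℕ × ℕ => ω pq.1 pq.2 * t ^ pq.1 * z ^ pq.2) w ∧
        Complex.exp w = (g t - g z) / (t - z))
    {z : ℂ} (hz1 : ‖z‖ < 1) (hz : z ≠ 0) :
    ∃ U V, HasSum (fun q => ω 0 q * z ^ q) U ∧ HasSum (fun q => ω 1 q * z ^ q) V ∧
      Complex.exp U = g z / z ∧ Complex.exp (-U) = 1 - z * V := by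
  have hzb : z ∈ Metric.ball (0 : ℂ) 1 := by simpa using hz1
  have hnz : 0 < ‖z‖ := norm_pos_iff.2 hz
  have hmem : ∀ t : ℂ, ‖t‖ ≤ ‖z‖ / 2 → t ∈ Metric.ball (0 : ℂ) 1 ∧ t ≠ z := by
    intro t ht
    refine ⟨by simp; linarith, ?_⟩
    rintro rfl
    linarith
  have hrow : ∀ p, Summable fun q => ω p q * z ^ q := by
    intro p
    have ht : ‖z / 2‖ ≤ ‖z‖ / 2 := by simp
    obtain ⟨w, hw, -⟩ := hω _ (hmem _ ht).1 z hzb (hmem _ ht).2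
    have h1 := (hw.summable.prod_factor p).mul_left ((z / 2) ^ p)⁻¹
    refine h1.congr fun q => ?_
    have : (z / 2) ^ p ≠ 0 := pow_ne_zero _ (div_ne_zero hz two_ne_zero)
    field_simp
  set A : ℕ → ℂ := fun p => ∑' q, ω p q * z ^ q with hA
  have hsum : ∀ t : ℂ, ‖t‖ ≤ ‖z‖ / 2 → ∃ w, HasSum (fun p => A p * t ^ p) w ∧
      Complex.exp w = (g t - g z) / (t - z) := by
    intro t ht
    obtain ⟨w, hw, he⟩ := hω t (hmem t ht).1 z hzb (hmem t ht).2
    refine ⟨w, hw.prod_fiberwise fun p => ?_, he⟩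
    convert! (hrow p).hasSum.mul_right (t ^ p) using 2
    ring
  refine ⟨A 0, A 1, (hrow 0).hasSum, (hrow 1).hasSum, ?_,
    exp_neg_eq_of_difference_quotient hg hg0 hz hsum⟩
  obtain ⟨w, hw, he⟩ := hsum 0 (by rw [norm_zero]; positivity)
  have h0 : HasSum (fun p => A p * (0 : ℂ) ^ p) (A 0) := by
    simpa using hasSum_single (f := fun p => A p * (0 : ℂ) ^ p) 0 (fun n hn => by simp [hn])
  rw [← hw.unique h0, he, hg0]
  simp [neg_div_neg_eq]

theorem stmt_9 (f : ℂ → ℂ) (hA : AnalyticOn ℂ f (Metric.ball 0 1))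
    (hI : Set.InjOn f (Metric.ball 0 1))
    (hf0 : f 0 = 0) (hf1 : deriv f 0 = 1)
    (γ : ℕ → ℂ)
    (hγ : ∀ z ∈ Metric.ball (0:ℂ) 1, z ≠ 0 →
      ∃ w, HasSum (fun n => 2 * γ (n + 1) * z ^ (n + 1)) w ∧ Complex.exp w = f z / z)
    (f₂ : ℂ → ℂ) (hA₂ : AnalyticOn ℂ f₂ (Metric.ball 0 1))
    (hsq : ∀ z ∈ Metric.ball (0:ℂ) 1, (f₂ z) ^ 2 = f (z ^ 2))
    (hd₂ : deriv f₂ 0 = 1)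
    (ω : ℕ → ℕ → ℂ) (hsym : ∀ p q, ω p q = ω q p)
    (hω : ∀ t ∈ Metric.ball (0:ℂ) 1, ∀ z ∈ Metric.ball (0:ℂ) 1, t ≠ z →
      ∃ w, HasSum (fun pq : ℕ × ℕ => ω pq.1 pq.2 * t ^ pq.1 * z ^ pq.2) w ∧
        Complex.exp w = (f₂ t - f₂ z) / (t - z)) :
    γ 4 = ω 1 7 + ω 1 1 * ω 1 5 + ω 1 1 ^ 2 * ω 1 3 + ω 1 3 ^ 2 / 2 + ω 1 1 ^ 4 / 4 := by
  have hg0 : f₂ 0 = 0 := by simpa [hf0] using hsq 0 (by simp)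
  have hg : HasDerivAt f₂ 1 0 := by
    rw [← hd₂]
    exact (differentiableAt_of_deriv_ne_zero (by rw [hd₂]; exact one_ne_zero)).hasDerivAt
  set d : ℕ → ℂ := fun q => 2 * ω 0 q - if Even q ∧ q ≠ 0 then 2 * γ (q / 2) else 0 with hd
  have hd0 : ∀ n, d (n + 1) = 0 := by
    intro n
    have := coeff_recursion_of_exp (w := d) (v := fun n => if n = 0 then 1 else 0)
      (r := 1 / 2) (by norm_num) (fun z hz hz0 => by
        have hz1 : ‖z‖ < 1 := by linarith
        obtain ⟨U, V, hU, -, heU, -⟩ := exists_hasSum_grunsky_rows hg hg0 hω hz1 hz0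
        have hz2 : z ^ 2 ∈ Metric.ball (0 : ℂ) 1 := by
          simpa using pow_lt_one₀ (norm_nonneg z) hz1 two_ne_zero
        obtain ⟨G, hG, heG⟩ := hγ (z ^ 2) hz2 (pow_ne_zero 2 hz0)
        have hG' : HasSum (fun q => (if Even q ∧ q ≠ 0 then 2 * γ (q / 2) else 0) * z ^ q) G := by
          have hinj : Function.Injective fun n : ℕ => 2 * (n + 1) := fun a b hab => by
            simp only at hab; omega
          refine (hinj.hasSum_iff ?_).1 ?_
          · intro q hq
            rw [if_neg, zero_mul]
            rintro ⟨⟨m, rfl⟩, hm⟩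
            exact hq ⟨m - 1, by simp only; omega⟩
          · convert! hG using 2 with n
            simp [pow_mul]
        refine ⟨2 * U - G, ?_, ?_⟩
        · convert! (hU.mul_left 2).sub hG' using 2
          simp only [hd]
          ring
        · have h1 : Complex.exp (2 * U - G) = 1 := by
            have hne := Complex.exp_ne_zero U
            have hne2 := Complex.exp_ne_zero G
            rw [Complex.exp_sub, two_mul, Complex.exp_add, div_eq_one_iff_eq hne2, heU, heG,
              ← hsq z (by simpa using hz1)]
            field_simp
          rw [h1]
          convert! hasSum_single (f := fun n => (if n = 0 then (1 : ℂ) else 0) * z ^ n) 0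
            (fun n hn => by simp [hn]) using 1
          simp) n
    simp only [Nat.succ_ne_zero, if_false, mul_zero, Finset.sum_range_succ] at this
    rw [Finset.sum_eq_zero] at this
    · have hn : (n : ℂ) + 1 ≠ 0 := by exact_mod_cast n.succ_ne_zero
      simpa [hn] using this
    · intro k hk
      have := Finset.mem_range.1 hk
      rw [if_neg (by omega), mul_zero]
  have hrec := coeff_recursion_of_exp (w := fun q => -ω 0 q)
      (v := fun n => if n = 0 then 1 else -ω 1 (n - 1)) (r := 1 / 2) (by norm_num)
      (fun z hz hz0 => by
        obtain ⟨U, V, hU, hV, -, heV⟩ :=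
          exists_hasSum_grunsky_rows hg hg0 hω (show ‖z‖ < 1 by linarith) hz0
        refine ⟨-U, by simpa using hU.neg, ?_⟩
        rw [heV, ← hasSum_nat_add_iff' 1]
        convert! (hV.mul_left z).neg using 1
        · ext n
          simp only [Nat.succ_ne_zero, if_false, Nat.add_sub_cancel]
          ring
        · simp)
  have u1 : ω 0 1 = 0 := by simpa [hd] using hd0 0
  have u3 : ω 0 3 = 0 := by simpa [hd, show ¬ Even 3 by decide] using hd0 2
  have u5 : ω 0 5 = 0 := by simpa [hd, show ¬ Even 5 by decide] using hd0 4
  have u7 : ω 0 7 = 0 := by simpa [hd, show ¬ Even 7 by decide] using hd0 6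
  have u8 : ω 0 8 - γ 4 = 0 := by
    have := hd0 7
    simp only [hd] at this
    rw [if_pos ⟨by decide, by norm_num⟩] at this
    norm_num at this
    linear_combination this / 2
  have r2 := hrec 1
  have r4 := hrec 3
  have r6 := hrec 5
  have r8 := hrec 7
  simp only [Finset.sum_range_succ, Finset.sum_range_zero, u1, u3, u5, u7] at r2 r4 r6 r8
  norm_num at r2 r4 r6 r8
  have e1 : ω 0 2 = ω 1 1 := by linear_combination -r2
  rw [e1] at r4 r6 r8
  have e2 : ω 0 4 = ω 1 3 + ω 1 1 ^ 2 / 2 := by linear_combination r4 / 4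
  rw [e2] at r6 r8
  have e3 : ω 0 6 = ω 1 5 + ω 1 1 * ω 1 3 + ω 1 1 ^ 3 / 3 := by linear_combination r6 / 6
  rw [e3] at r8
  linear_combination -u8 + r8 / 8
end
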